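/- Let a, b ≥ 0 be natural numbers, set n = a + b + 1, and define the weight λ : Fin n → ℤ by λ i = 0 for i < a, λ i = −1 for a ≤ i < a + b, and λ (n−1) = b. Then there exists a unique permutation σ of Fin n with σ • λ non-increasing; for this σ one has σ • λ = 0 (the identically zero weight), and the number of inversions of σ (the cardinality of {(i,j) : i < j and σ i > σ j}) equals b. -/

import Mathlib

/-- The shifted half sum of positive roots of `GL(n)`: `ρ i = (n - 1) - i`. -/
def rho (n : ℕ) : Fin n → ℤ := fun i => ((n : ℤ) - 1) - (i : ℤ)

/-- The dot action of a permutation on a `GL(n)`-weight: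
`(σ • λ) i = λ (σ⁻¹ i) + ρ (σ⁻¹ i) - ρ i`, i.e. `σ • λ = σ(λ + ρ) - ρ`. -/
def dotAct {n : ℕ} (σ : Equiv.Perm (Fin n)) (l : Fin n → ℤ) : Fin n → ℤ :=
  fun i => l (σ⁻¹ i) + rho n (σ⁻¹ i) - rho n i

/-- The cycle of `Fin (a + b + 1)` that fixes every `i < a`, moves each `i` with `a ≤ i < a + b` one
step up, and sends the last element to `a`. -/
noncomputable def insertLastAt (a b : ℕ) : Equiv.Perm (Fin (a + b + 1)) :=
  Equiv.ofBijective
    (fun i => ⟨if (i : ℕ) < a then i else if (i : ℕ) < a + b then i + 1 else a, by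
      split_ifs <;> omega⟩)
    (Finite.injective_iff_bijective.mp fun i j h => by
      simp only [Fin.mk.injEq] at h
      ext
      split_ifs at h <;> omega)

lemma insertLastAt_val (a b : ℕ) (i : Fin (a + b + 1)) :
    (insertLastAt a b i : ℕ) =
      if (i : ℕ) < a then (i : ℕ) else if (i : ℕ) < a + b then i + 1 else a :=
  rfl

lemma perm_eq_one_of_strictMono {n : ℕ} {σ : Equiv.Perm (Fin n)} (h : StrictMono σ) : σ = 1 :=
  Equiv.coe_fn_injective <| (h.range_inj strictMono_id).mp <| by
    rw [σ.surjective.range_eq, Set.range_id]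

lemma dotAct_eq_zero_of_add_rho {n : ℕ} {l : Fin n → ℤ} {τ : Equiv.Perm (Fin n)}
    (h : ∀ i, l i + rho n i = rho n (τ i)) : dotAct τ l = 0 := by
  funext i
  simp [dotAct, h]

/-- If `l + ρ` is the rearrangement `ρ ∘ τ` of `ρ`, then `τ` is the only permutation whose dot
action can make `l` dominant. -/
lemma eq_of_antitone_dotAct {n : ℕ} {l : Fin n → ℤ} {σ τ : Equiv.Perm (Fin n)}
    (h : ∀ i, l i + rho n i = rho n (τ i)) (hσ : Antitone (dotAct σ l)) : σ = τ := by
  have hmono : StrictMono (τ * σ⁻¹) := fun i j hij => by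
    have hle := hσ hij.le
    simp only [dotAct, h] at hle
    simp only [rho] at hle
    rw [Equiv.Perm.mul_apply, Equiv.Perm.mul_apply]
    rw [Fin.lt_def] at hij ⊢
    omega
  exact (mul_inv_eq_one.mp (perm_eq_one_of_strictMono hmono)).symm

lemma card_inversions_insertLastAt (a b : ℕ) :
    (Finset.univ.filter
      (fun p : Fin (a + b + 1) × Fin (a + b + 1) =>
        p.1 < p.2 ∧ insertLastAt a b p.2 < insertLastAt a b p.1)).card = b := by
  conv_rhs => rw [← Finset.card_fin b]
  symm
  refine Finset.card_bij (fun k _ => (⟨a + k, by omega⟩, Fin.last (a + b))) ?_ ?_ ?_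
  · intro k _
    simp only [Finset.mem_filter, Finset.mem_univ, true_and, Fin.lt_def, insertLastAt_val,
      Fin.val_last]
    split_ifs <;> omega
  · intro k _ m _ hkm
    simpa [Fin.ext_iff] using hkm
  · rintro ⟨i, j⟩ hij
    simp only [Finset.mem_filter, Finset.mem_univ, true_and, Fin.lt_def, insertLastAt_val] at hij
    have hbounds : a ≤ (i : ℕ) ∧ (i : ℕ) < a + b ∧ (j : ℕ) = a + b := by
      obtain ⟨hlt, hinv⟩ := hij
      split_ifs at hinv <;> omega
    refine ⟨⟨i - a, by omega⟩, Finset.mem_univ _, ?_⟩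
    simp only [Prod.mk.injEq, Fin.ext_iff, Fin.val_last]
    omega

/-- The weight `(0, …, 0, -1, …, -1, b)` with `a` zeros and `b` entries `-1` is
permuted by a unique Weyl element into a dominant weight; this dominant weight
is the zero weight and the Weyl element has exactly `b` inversions. -/
theorem weight_zeros_negOnes_b_dominant (a b : ℕ) :
    (∃! σ : Equiv.Perm (Fin (a + b + 1)),
      ∀ i j : Fin (a + b + 1), i ≤ j →
        dotAct σ (fun i : Fin (a + b + 1) =>
            if (i : ℕ) < a then (0 : ℤ)
            else if (i : ℕ) < a + b then -1 else (b : ℤ)) j ≤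
        dotAct σ (fun i : Fin (a + b + 1) =>
            if (i : ℕ) < a then (0 : ℤ)
            else if (i : ℕ) < a + b then -1 else (b : ℤ)) i) ∧
    ∀ σ : Equiv.Perm (Fin (a + b + 1)),
      (∀ i j : Fin (a + b + 1), i ≤ j →
        dotAct σ (fun i : Fin (a + b + 1) =>
            if (i : ℕ) < a then (0 : ℤ)
            else if (i : ℕ) < a + b then -1 else (b : ℤ)) j ≤
        dotAct σ (fun i : Fin (a + b + 1) =>
            if (i : ℕ) < a then (0 : ℤ)
            else if (i : ℕ) < a + b then -1 else (b : ℤ)) i) →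
      dotAct σ (fun i : Fin (a + b + 1) =>
          if (i : ℕ) < a then (0 : ℤ)
          else if (i : ℕ) < a + b then -1 else (b : ℤ)) = 0 ∧
      (Finset.univ.filter
          (fun p : Fin (a + b + 1) × Fin (a + b + 1) =>
            p.1 < p.2 ∧ σ p.2 < σ p.1)).card = b := by
  have h : ∀ i : Fin (a + b + 1),
      (if (i : ℕ) < a then (0 : ℤ) else if (i : ℕ) < a + b then -1 else (b : ℤ)) +
        rho (a + b + 1) i = rho (a + b + 1) (insertLastAt a b i) := fun i => by
    simp only [rho, insertLastAt_val]
    split_ifs <;> push_cast <;> omega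
  refine ⟨⟨insertLastAt a b, fun i j _ => ?_, fun σ hσ => ?_⟩, fun σ hσ => ?_⟩
  · rw [dotAct_eq_zero_of_add_rho h]
    rfl
  · exact eq_of_antitone_dotAct h fun i j hij => hσ i j hij
  · obtain rfl := eq_of_antitone_dotAct h fun i j hij => hσ i j hij
    exact ⟨dotAct_eq_zero_of_add_rho h, card_inversions_insertLastAt a b⟩
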